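/- arXiv:2510.22325 — 2 statements merged into one kernel-verified Lean document; each statement's English description precedes it below -/
import Mathlib

section
/- Let S be a nonempty finite set and let Λ_1, …, Λ_m ∈ ℕ^S be finitely many vectors such that each Λ_i has coordinate sum |Λ_i| ≥ 2 and every coordinate Λ_{i,ρ} ≤ 2. Let μ_loc and μ be the associated local and global Möbius functions and Π(d) = Π_{ρ∈S} d_ρ. Then the family ( μ(d)/Π(d) ) indexed by d ∈ (ℕ_{>0})^S is absolutely summable, the product over all primes p of the (finite) sums Σ_{λ ∈ ℕ^S} μ_loc(λ) p^{−|λ|} is absolutely convergent, and Σ_{d ∈ (ℕ_{>0})^S} μ(d)/Π(d) = Π_p ( Σ_{λ ∈ ℕ^S} μ_loc(λ) p^{−|λ|} ). -/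
/-- The global Möbius function `μ(d) = Π_p μloc((v_p(d_ρ))_ρ)`, a product over all primes
with only finitely many factors different from `1`. -/
noncomputable def muGlob {S : Type*} (μloc : (S → ℕ) → ℤ) (d : S → ℕ) : ℤ :=
  ∏ᶠ (p : ℕ) (_ : p.Prime), μloc fun ρ => (d ρ).factorization p

section Local

variable {S : Type*} [Fintype S] [DecidableEq S] {m : ℕ} {Λ : Fin m → S → ℕ}
  {μloc : (S → ℕ) → ℤ}

/-- The local Möbius function takes the value `1` at the origin. -/
lemma localMobius_zero (hsum : ∀ i, 2 ≤ ∑ ρ, Λ i ρ)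
    (hμ : ∀ τ : S → ℕ,
      (if ∀ i, ∃ ρ, τ ρ < Λ i ρ then (1 : ℤ) else 0) = ∑ l ∈ Finset.Iic τ, μloc l) :
    μloc 0 = 1 := by
  have h := hμ 0
  have h0 : Finset.Iic (0 : S → ℕ) = {0} := by
    ext l
    simp
  rw [h0, Finset.sum_singleton, if_pos] at h
  · exact h.symm
  · intro i
    by_contra! hc
    have := hsum i
    rw [Finset.sum_eq_zero fun ρ _ => Nat.le_zero.mp (hc ρ)] at this
    omega

/-- The local Möbius function vanishes at vectors with a coordinate larger than `2`. -/
lemma localMobius_eq_zero_of_two_lt (hle : ∀ i ρ, Λ i ρ ≤ 2)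
    (hμ : ∀ τ : S → ℕ,
      (if ∀ i, ∃ ρ, τ ρ < Λ i ρ then (1 : ℤ) else 0) = ∑ l ∈ Finset.Iic τ, μloc l)
    (l : S → ℕ) (ρ : S) (hρ : 2 < l ρ) : μloc l = 0 := by
  induction l using WellFoundedLT.induction with
  | ind l ih =>
    let k : S → ℕ := Function.update l ρ 2
    have hkl : k ≤ l := by
      intro σ
      by_cases h : σ = ρ
      · subst h; simp [k]; omega
      · simp [k, h]
    have hind : (∀ i, ∃ σ, l σ < Λ i σ) ↔ ∀ i, ∃ σ, k σ < Λ i σ := by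
      refine forall_congr' fun i => exists_congr fun σ => ?_
      by_cases h : σ = ρ
      · subst h; have := hle i σ; simp [k]; omega
      · simp [k, h]
    have heq : ∑ j ∈ Finset.Iic l, μloc j = ∑ j ∈ Finset.Iic k, μloc j := by
      rw [← hμ, ← hμ, if_congr hind rfl rfl]
    rw [← Finset.sum_sdiff (Finset.Iic_subset_Iic.mpr hkl)] at heq
    rw [add_eq_right, Finset.sum_eq_single l] at heq
    · exact heq
    · intro j hj hjl
      simp only [Finset.mem_sdiff, Finset.mem_Iic] at hj
      refine ih j (lt_of_le_of_ne hj.1 hjl) ?_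
      by_contra! hc
      refine hj.2 fun σ => ?_
      by_cases h : σ = ρ
      · subst h; simpa [k] using hc
      · simpa [k, h] using hj.1 σ
    · intro h
      refine absurd ?_ h
      simp only [Finset.mem_sdiff, Finset.mem_Iic, le_refl, true_and]
      intro h
      have := h ρ
      simp [k] at this
      omega

/-- The local Möbius function vanishes at vectors of coordinate sum `1`. -/
lemma localMobius_eq_zero_of_sum_lt_two (hsum : ∀ i, 2 ≤ ∑ ρ, Λ i ρ)
    (hμ : ∀ τ : S → ℕ,
      (if ∀ i, ∃ ρ, τ ρ < Λ i ρ then (1 : ℤ) else 0) = ∑ l ∈ Finset.Iic τ, μloc l)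
    (l : S → ℕ) (hl0 : l ≠ 0) (hl : ∑ ρ, l ρ < 2) : μloc l = 0 := by
  have h := hμ l
  have h0 : Finset.Iic l = {0, l} := by
    ext j
    simp only [Finset.mem_Iic, Finset.mem_insert, Finset.mem_singleton]
    constructor
    · intro hj
      by_contra! hc
      have hlt : ∑ ρ, j ρ < ∑ ρ, l ρ := by
        refine Finset.sum_lt_sum (fun ρ _ => hj ρ) ?_
        obtain ⟨-, ρ, hρ⟩ := Pi.lt_def.mp (lt_of_le_of_ne hj hc.2)
        exact ⟨ρ, Finset.mem_univ _, hρ⟩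
      have hz : ∑ ρ, j ρ = 0 := by omega
      refine hc.1 (funext fun ρ => ?_)
      exact Finset.sum_eq_zero_iff.mp hz ρ (Finset.mem_univ _)
    · rintro (rfl | rfl)
      · exact fun _ => Nat.zero_le _
      · exact le_rfl
  rw [h0, Finset.sum_pair hl0.symm, localMobius_zero hsum hμ, if_pos] at h
  · omega
  · intro i
    by_contra! hc
    have h1 := hsum i
    have h2 := Finset.sum_le_sum fun ρ (_ : ρ ∈ Finset.univ) => hc ρ
    omega

end Local

section Tuples

variable {S : Type*} {T : Finset (S → ℕ)}

/-- Extension by zero of a family of exponent vectors indexed by a finite set of primes. -/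
def extendExponents (e : Σ s : Finset Nat.Primes, s → T) (p : Nat.Primes) : S → ℕ :=
  if h : p ∈ e.1 then (e.2 ⟨p, h⟩ : S → ℕ) else 0

/-- The tuple of positive integers with prescribed exponent vectors at finitely many primes. -/
def tupleOfExponents (e : Σ s : Finset Nat.Primes, s → T) : {d : S → ℕ // ∀ ρ, 0 < d ρ} :=
  ⟨fun ρ => ∏ p ∈ e.1, (p : ℕ) ^ extendExponents e p ρ,
    fun _ => Finset.prod_pos fun p _ => pow_pos p.2.pos _⟩

lemma extendExponents_of_mem (e : Σ s : Finset Nat.Primes, s → T) (p : e.1) :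
    extendExponents e p = e.2 p := by
  simp [extendExponents]

lemma extendExponents_of_notMem (e : Σ s : Finset Nat.Primes, s → T) {p : Nat.Primes}
    (hp : p ∉ e.1) : extendExponents e p = 0 := by
  simp [extendExponents, hp]

lemma factorization_tupleOfExponents (e : Σ s : Finset Nat.Primes, s → T) (p : Nat.Primes) :
    (fun ρ => ((tupleOfExponents e).1 ρ).factorization p) = extendExponents e p := by
  funext ρ
  simp only [tupleOfExponents]
  rw [Nat.factorization_prod fun q _ => pow_ne_zero _ q.2.ne_zero, Finsupp.finsetSum_apply]
  have hterm : ∀ q : Nat.Primes, (((q : ℕ) ^ extendExponents e q ρ).factorization) (p : ℕ)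
      = if q = p then extendExponents e p ρ else 0 := by
    intro q
    rw [q.2.factorization_pow]
    by_cases h : q = p
    · subst h; simp
    · have hne : (q : ℕ) ≠ p := fun hc => h (Subtype.ext hc)
      simp [h, hne]
  rw [Finset.sum_congr rfl fun q _ => hterm q, Finset.sum_ite_eq']
  split_ifs with h
  · rfl
  · rw [extendExponents_of_notMem e h]; rfl

lemma tupleOfExponents_injective (hT : 0 ∉ T) :
    Function.Injective (tupleOfExponents (T := T)) := by
  intro e f hef
  have hext : extendExponents e = extendExponents f := by
    funext p
    rw [← factorization_tupleOfExponents, ← factorization_tupleOfExponents, hef]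
  have hmem : ∀ (g : Σ s : Finset Nat.Primes, s → T) p, p ∈ g.1 ↔ extendExponents g p ≠ 0 := by
    intro g p
    by_cases h : p ∈ g.1
    · have h1 : extendExponents g p = g.2 ⟨p, h⟩ := extendExponents_of_mem g ⟨p, h⟩
      simp only [h, true_iff, h1]
      exact fun h0 => hT (h0 ▸ (g.2 ⟨p, h⟩).2)
    · simp [h, extendExponents_of_notMem g h]
  obtain ⟨s, x⟩ := e
  obtain ⟨t, y⟩ := f
  obtain rfl : s = t := by
    ext p
    exact (hmem ⟨s, x⟩ p).trans (hext ▸ (hmem ⟨t, y⟩ p).symm)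
  congr 1
  funext p
  have h := congrFun hext p
  rw [extendExponents_of_mem ⟨s, x⟩ p, extendExponents_of_mem ⟨s, y⟩ p] at h
  exact Subtype.ext h

lemma muGlob_eq_finprod_primes (μloc : (S → ℕ) → ℤ) (d : S → ℕ) :
    muGlob μloc d = ∏ᶠ p : Nat.Primes, μloc fun ρ => (d ρ).factorization p :=
  (finprod_subtype_eq_finprod_cond (f := fun p : ℕ => μloc fun ρ => (d ρ).factorization p)
    Nat.Prime).symm

lemma muGlob_tupleOfExponents {μloc : (S → ℕ) → ℤ} (h0 : μloc 0 = 1)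
    (e : Σ s : Finset Nat.Primes, s → T) :
    muGlob μloc (tupleOfExponents e).1 = ∏ p : e.1, μloc (e.2 p) := by
  rw [muGlob_eq_finprod_primes]
  simp only [factorization_tupleOfExponents]
  rw [finprod_eq_prod_of_mulSupport_subset (s := e.1), ← Finset.prod_coe_sort]
  · exact Finset.prod_congr rfl fun p _ => by rw [extendExponents_of_mem]
  · intro p hp
    by_contra h
    exact hp (by simp only [extendExponents_of_notMem e h, h0])

lemma prod_tupleOfExponents [Fintype S] (e : Σ s : Finset Nat.Primes, s → T) :
    ∏ ρ, (tupleOfExponents e).1 ρ = ∏ p : e.1, (p : ℕ) ^ ∑ ρ, (e.2 p : S → ℕ) ρ := by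
  simp only [tupleOfExponents]
  rw [Finset.prod_comm, ← Finset.prod_coe_sort]
  refine Finset.prod_congr rfl fun p _ => ?_
  rw [Finset.prod_pow_eq_pow_sum, extendExponents_of_mem]

lemma mem_range_tupleOfExponents [Fintype S] {μloc : (S → ℕ) → ℤ} (h0 : μloc 0 = 1)
    (hsupp : ∀ l, l ≠ 0 → μloc l ≠ 0 → l ∈ T) (d : {d : S → ℕ // ∀ ρ, 0 < d ρ})
    (hd : muGlob μloc d.1 ≠ 0) : d ∈ Set.range (tupleOfExponents (T := T)) := by
  classical
  rw [muGlob_eq_finprod_primes] at hd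
  let v : Nat.Primes → S → ℕ := fun p ρ => (d.1 ρ).factorization p
  have hfin : {p | v p ≠ 0}.Finite := by
    have hsub : {p | v p ≠ 0} ⊆ (fun p : Nat.Primes => (p : ℕ)) ⁻¹'
        ((Finset.univ.biUnion fun ρ => (d.1 ρ).primeFactors : Finset ℕ) : Set ℕ) := by
      intro p hp
      obtain ⟨ρ, hρ⟩ := Function.ne_iff.mp hp
      simp only [Set.mem_preimage, Finset.coe_biUnion, Set.mem_iUnion, Finset.mem_coe]
      refine ⟨ρ, Finset.mem_univ _, ?_⟩
      rw [← Nat.support_factorization, Finsupp.mem_support_iff]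
      exact hρ
    exact ((Finset.finite_toSet _).preimage Subtype.val_injective.injOn).subset hsub
  have hne : ∀ p, μloc (v p) ≠ 0 := by
    rw [finprod_eq_prod_of_mulSupport_subset (s := hfin.toFinset), Finset.prod_ne_zero_iff] at hd
    · intro p
      by_cases h : v p = 0
      · simp [h, h0]
      · exact hd p (by simpa using h)
    · intro p hp
      rw [Set.Finite.coe_toFinset]
      intro h
      exact hp (by change μloc (v p) = 1; rw [h, h0])
  let e : Σ s : Finset Nat.Primes, s → T :=
    ⟨hfin.toFinset, fun p => ⟨v p, hsupp _ (hfin.mem_toFinset.mp p.2) (hne p)⟩⟩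
  have hext : ∀ p, extendExponents e p = v p := by
    intro p
    by_cases h : p ∈ e.1
    · exact extendExponents_of_mem e ⟨p, h⟩
    · rw [extendExponents_of_notMem e h]
      simpa [e, eq_comm] using h
  refine ⟨e, Subtype.ext (funext fun ρ => ?_)⟩
  refine Nat.eq_of_factorization_eq ((tupleOfExponents e).2 ρ).ne' (d.2 ρ).ne' fun p => ?_
  by_cases hp : p.Prime
  · have h := congrFun (factorization_tupleOfExponents e ⟨p, hp⟩) ρ
    exact h.trans (congrFun (hext ⟨p, hp⟩) ρ)
  · rw [Nat.factorization_eq_zero_of_not_prime _ hp, Nat.factorization_eq_zero_of_not_prime _ hp]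

end Tuples

/-- A sum of terms `c t * p ^ (-w t)` with all weights at least `2` is summable over primes. -/
lemma summable_primes_sum_div_pow {ι : Type*} [Fintype ι] (c : ι → ℝ) (w : ι → ℕ)
    (hw : ∀ t, 2 ≤ w t) :
    Summable fun p : Nat.Primes => ∑ t, c t / ((p : ℕ) : ℝ) ^ w t := by
  refine summable_sum fun t _ => ?_
  have h2 : Summable fun p : Nat.Primes => |c t| * (1 / ((p : ℕ) : ℝ) ^ 2) :=
    (((Real.summable_one_div_nat_pow (p := 2)).mpr one_lt_two).comp_injective
      Subtype.val_injective).mul_left _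
  refine Summable.of_norm_bounded h2 fun p => ?_
  have hp : (1 : ℝ) ≤ ((p : ℕ) : ℝ) := by exact_mod_cast p.2.one_le
  rw [norm_div, norm_pow, Real.norm_natCast, Real.norm_eq_abs, div_eq_mul_one_div]
  gcongr
  exact hw t

/-- Expansion of a product of finite sums `1 + ∑ t, g p t`, absolutely summable over `p`. -/
lemma summable_sigma_prod_and_tprod_eq {P ι : Type*} [Fintype ι] [DecidableEq P] (g : P → ι → ℝ)
    (hg : Summable fun p => ∑ t, |g p t|) :
    Summable (fun e : Σ s : Finset P, s → ι => |∏ p : e.1, g p (e.2 p)|) ∧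
    Multipliable (fun p => 1 + ∑ t, g p t) ∧
    ∑' e : Σ s : Finset P, s → ι, ∏ p : e.1, g p (e.2 p) = ∏' p, (1 + ∑ t, g p t) := by
  have habs : Summable (fun e : Σ s : Finset P, s → ι => |∏ p : e.1, g p (e.2 p)|) := by
    rw [summable_sigma_of_nonneg fun _ => abs_nonneg _]
    refine ⟨fun s => Summable.of_finite, ?_⟩
    have h := summable_finsetProd_of_summable_nonneg
      (fun p => Finset.sum_nonneg fun t _ => abs_nonneg (g p t)) hg
    refine h.congr fun s => ?_
    rw [tsum_fintype, ← Finset.prod_coe_sort, Fintype.prod_sum]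
    simp only [Finset.abs_prod]
  have hnorm : Summable fun p => ‖∑ t, g p t‖ :=
    hg.of_nonneg_of_le (fun _ => norm_nonneg _) fun p => Finset.abs_sum_le_sum_abs _ _
  refine ⟨habs, multipliable_one_add_of_summable hnorm, ?_⟩
  rw [tprod_one_add (summable_finsetProd_of_summable_norm hnorm),
    habs.of_abs.tsum_sigma' fun s => Summable.of_finite]
  refine tsum_congr fun s => ?_
  rw [tsum_fintype, ← Finset.prod_coe_sort, Fintype.prod_sum]

/-- The family `μ(d)/Π(d)` is absolutely summable over positive tuples `d`, the product
over primes of the finite sums `Σ_λ μloc(λ) p^{-|λ|}` converges absolutely, and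
`Σ_d μ(d)/Π(d) = Π_p Σ_λ μloc(λ) p^{-|λ|}`. -/
theorem stmt12 (S : Type*) [Fintype S] [DecidableEq S] [Nonempty S]
    (m : ℕ) (Λ : Fin m → S → ℕ)
    (hsum : ∀ i, 2 ≤ ∑ ρ, Λ i ρ) (hle : ∀ i ρ, Λ i ρ ≤ 2)
    (μloc : (S → ℕ) → ℤ)
    (hμ : ∀ τ : S → ℕ,
      (if ∀ i, ∃ ρ, τ ρ < Λ i ρ then (1 : ℤ) else 0) = ∑ l ∈ Finset.Iic τ, μloc l) :
    Summable (fun d : {d : S → ℕ // ∀ ρ, 0 < d ρ} =>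
        (|muGlob μloc d.1| : ℝ) / ((∏ ρ, d.1 ρ : ℕ) : ℝ)) ∧
    Multipliable (fun p : Nat.Primes =>
        ∑ᶠ l : S → ℕ, (μloc l : ℝ) * ((p : ℕ) : ℝ) ^ (-((∑ ρ, l ρ : ℕ) : ℤ))) ∧
    (∑' d : {d : S → ℕ // ∀ ρ, 0 < d ρ},
        (muGlob μloc d.1 : ℝ) / ((∏ ρ, d.1 ρ : ℕ) : ℝ))
      = ∏' p : Nat.Primes,
          ∑ᶠ l : S → ℕ, (μloc l : ℝ) * ((p : ℕ) : ℝ) ^ (-((∑ ρ, l ρ : ℕ) : ℤ)) := by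
  have h0 := localMobius_zero hsum hμ
  let T : Finset (S → ℕ) := (Finset.Iic fun _ => 2).filter fun l => 2 ≤ ∑ ρ, l ρ
  have hT : (0 : S → ℕ) ∉ T := by simp [T]
  have hT2 : ∀ t : T, 2 ≤ ∑ ρ, (t : S → ℕ) ρ := fun t => (Finset.mem_filter.mp t.2).2
  have hsupp : ∀ l, l ≠ 0 → μloc l ≠ 0 → l ∈ T := by
    intro l hl hμl
    refine Finset.mem_filter.mpr ⟨Finset.mem_Iic.mpr fun ρ => ?_, ?_⟩
    · by_contra! h
      exact hμl (localMobius_eq_zero_of_two_lt hle hμ l ρ h)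
    · by_contra! h
      exact hμl (localMobius_eq_zero_of_sum_lt_two hsum hμ l hl h)
  let g : Nat.Primes → T → ℝ := fun p t => (μloc t : ℝ) / ((p : ℕ) : ℝ) ^ ∑ ρ, (t : S → ℕ) ρ
  have hg : Summable fun p => ∑ t, |g p t| := by
    refine (summable_primes_sum_div_pow (fun t : T => |(μloc t : ℝ)|) _ hT2).congr fun p => ?_
    simp [g, abs_div]
  have hfactor : ∀ p : Nat.Primes,
      ∑ᶠ l : S → ℕ, (μloc l : ℝ) * ((p : ℕ) : ℝ) ^ (-((∑ ρ, l ρ : ℕ) : ℤ))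
        = 1 + ∑ t, g p t := by
    intro p
    rw [finsum_eq_sum_of_support_subset (s := insert 0 T), Finset.sum_insert hT,
      ← Finset.sum_coe_sort T]
    · congr 1
      · simp [h0]
      · refine Finset.sum_congr rfl fun t _ => ?_
        rw [zpow_neg, zpow_natCast, ← div_eq_mul_inv]
    · intro l hl
      by_cases h : l = 0
      · simp [h]
      · refine Finset.mem_insert_of_mem (hsupp l h fun hz => hl ?_)
        simp [hz]
  obtain ⟨h1, h2, h3⟩ := summable_sigma_prod_and_tprod_eq g hg
  have hterm : ∀ e : Σ s : Finset Nat.Primes, s → T,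
      (muGlob μloc (tupleOfExponents e).1 : ℝ) / ((∏ ρ, (tupleOfExponents e).1 ρ : ℕ) : ℝ)
        = ∏ p : e.1, g p (e.2 p) := by
    intro e
    rw [muGlob_tupleOfExponents h0, prod_tupleOfExponents]
    push_cast
    rw [← Finset.prod_div_distrib]
  have hinj := tupleOfExponents_injective hT
  have hrange := mem_range_tupleOfExponents (T := T) h0 hsupp
  simp only [hfactor]
  refine ⟨?_, h2, ?_⟩
  · rw [← hinj.summable_iff]
    · refine h1.congr fun e => ?_
      rw [← hterm, abs_div, Nat.abs_cast]
      simp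
    · intro d hd
      have hz : muGlob μloc d.1 = 0 := by
        by_contra h
        exact hd (hrange d h)
      simp [hz]
  · rw [← h3, ← hinj.tsum_eq]
    · exact tsum_congr hterm
    · intro d hd
      refine hrange d fun hz => hd ?_
      simp [hz]
end

section
/- Let S be a nonempty finite set and let Λ_1, …, Λ_m ∈ ℕ^S be finitely many vectors such that each Λ_i has coordinate sum |Λ_i| ≥ 2 and every coordinate Λ_{i,ρ} ≤ 2. Let μ be the associated global Möbius function and Π(d) = Π_{ρ∈S} d_ρ. Then for every ε ∈ (0, 1/2) there exists a constant C > 0 such that for every real Y > 1: Σ_{d ∈ (ℕ_{>0})^S, Π(d) ≥ Y} |μ(d)|/Π(d) ≤ C · Y^{−(1/2 − ε)}. -/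
open Finset in
/-- A summatory function unaffected by lowering the coordinate `ρ` from values `≥ 3`
has coefficients supported on `l ρ ≤ 2`. -/
theorem coeff_eq_zero_of_three_le {S : Type*} [Fintype S] [DecidableEq S]
    {f μloc : (S → ℕ) → ℤ} (hμ : ∀ τ, f τ = ∑ l ∈ Iic τ, μloc l) (ρ : S)
    (hf : ∀ τ : S → ℕ, 3 ≤ τ ρ → f (Function.update τ ρ (τ ρ - 1)) = f τ)
    (l : S → ℕ) (hl : 3 ≤ l ρ) : μloc l = 0 := by
  induction l using WellFoundedLT.induction with
  | ind l ih =>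
    have hle : Function.update l ρ (l ρ - 1) ≤ l := by
      intro σ
      by_cases h : σ = ρ
      · subst h; simp
      · simp [h]
    have hsub : Iic (Function.update l ρ (l ρ - 1)) ⊆ (Iic l).erase l := by
      intro k hk
      rw [mem_Iic] at hk
      rw [mem_erase, mem_Iic]
      refine ⟨?_, hk.trans hle⟩
      rintro rfl
      have := hk ρ
      simp at this
      omega
    have h1 : ∑ k ∈ Iic (Function.update l ρ (l ρ - 1)), μloc k
        = ∑ k ∈ (Iic l).erase l, μloc k := by
      refine sum_subset hsub fun k hk hk' => ?_
      rw [mem_erase, mem_Iic] at hk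
      rw [mem_Iic] at hk'
      refine ih k (lt_of_le_of_ne hk.2 hk.1) ?_
      by_contra! hlt
      refine hk' fun σ => ?_
      by_cases h : σ = ρ
      · subst h; simp; omega
      · simpa [h] using hk.2 σ
    have h2 := hf l hl
    rw [hμ, hμ l, h1, ← add_sum_erase _ _ (mem_Iic.2 le_rfl : l ∈ Iic l)] at h2
    linarith

open Finset in
/-- Coefficients of a summatory function equal to `1` on vectors of size at most one. -/
theorem coeff_zero_and_coeff_eq_zero_of_sum_eq_one {S : Type*} [Fintype S] [DecidableEq S]
    {f μloc : (S → ℕ) → ℤ} (hμ : ∀ τ, f τ = ∑ l ∈ Iic τ, μloc l)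
    (hf : ∀ τ : S → ℕ, ∑ ρ, τ ρ ≤ 1 → f τ = 1) :
    μloc 0 = 1 ∧ ∀ l : S → ℕ, ∑ ρ, l ρ = 1 → μloc l = 0 := by
  have h0 : μloc 0 = 1 := by
    have hI : Iic (0 : S → ℕ) = {0} := by
      ext k
      simp only [mem_Iic, mem_singleton]
      exact ⟨fun h => le_antisymm h fun _ => Nat.zero_le _, fun h => h.le⟩
    have := hμ 0
    rw [hf 0 (by simp), hI, sum_singleton] at this
    exact this.symm
  refine ⟨h0, fun l hl => ?_⟩
  have hI : Iic l = {0, l} := by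
    ext k
    simp only [mem_Iic, mem_insert, mem_singleton]
    constructor
    · intro h
      by_contra! hk
      obtain ⟨hk0, hkl⟩ := hk
      obtain ⟨_, σ, hσ⟩ := Pi.lt_def.1 (lt_of_le_of_ne h hkl)
      have hlt : ∑ ρ, k ρ < ∑ ρ, l ρ := sum_lt_sum (fun i _ => h i) ⟨σ, mem_univ _, hσ⟩
      rw [hl, Nat.lt_one_iff, sum_eq_zero_iff] at hlt
      exact hk0 (funext fun i => hlt i (mem_univ _))
    · rintro (rfl | rfl)
      · exact fun _ => Nat.zero_le _
      · exact le_rfl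
  have hne : (0 : S → ℕ) ≠ l := by
    rintro rfl
    simp at hl
  have := hμ l
  rw [hf l hl.le, hI, sum_pair hne, h0] at this
  linarith

/-- The global Möbius function as a finite product over a set of primes containing all
prime factors. -/
theorem muGlob_eq_prod {S : Type*} {μloc : (S → ℕ) → ℤ} (h0 : μloc 0 = 1) {d : S → ℕ}
    {P : Finset ℕ} (hP : ∀ p ∈ P, p.Prime) (hd : ∀ ρ, (d ρ).primeFactors ⊆ P) :
    muGlob μloc d = ∏ p ∈ P, μloc fun ρ => (d ρ).factorization p := by
  refine finprod_mem_eq_prod_of_inter_mulSupport_eq _ ?_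
  ext p
  simp only [Set.mem_inter_iff, Function.mem_mulSupport, Finset.mem_coe]
  refine ⟨fun ⟨_, h⟩ => ⟨?_, h⟩, fun ⟨h', h⟩ => ⟨hP p h', h⟩⟩
  by_contra hp
  refine h ?_
  rw [← h0]
  refine congrArg μloc (funext fun ρ => ?_)
  exact Finsupp.notMem_support_iff.1 fun h => hp (hd ρ h)

/-- The product of the coordinates in terms of the vectors of valuations. -/
theorem prod_eq_prod_pow_sum_factorization {S : Type*} [Fintype S] {d : S → ℕ}
    (hd0 : ∀ ρ, 0 < d ρ) {P : Finset ℕ} (hd : ∀ ρ, (d ρ).primeFactors ⊆ P) :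
    ∏ ρ, d ρ = ∏ p ∈ P, p ^ ∑ ρ, (d ρ).factorization p := by
  simp_rw [← Finset.prod_pow_eq_pow_sum]
  rw [Finset.prod_comm]
  refine Finset.prod_congr rfl fun ρ _ => ?_
  conv_lhs => rw [← Nat.prod_factorization_pow_eq_self (hd0 ρ).ne']
  exact Finsupp.prod_of_support_subset _ (hd ρ) _ (by simp)

/-- The local Euler factor is at most `1 + B p^{-2s}`. -/
theorem sum_abs_mul_rpow_le {S : Type*} [Fintype S] {μloc : (S → ℕ) → ℤ} (h0 : μloc 0 = 1)
    (h1 : ∀ l : S → ℕ, ∑ ρ, l ρ = 1 → μloc l = 0) (T : Finset (S → ℕ)) {s : ℝ} (hs : 0 < s)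
    {p : ℕ} (hp : 1 ≤ p) :
    ∑ l ∈ T, |(μloc l : ℝ)| * ((p : ℝ) ^ (∑ ρ, l ρ)) ^ (-s)
      ≤ 1 + (∑ l ∈ T, |(μloc l : ℝ)|) * (p : ℝ) ^ (-(2 * s)) := by
  classical
  have hp' : (1 : ℝ) ≤ p := by exact_mod_cast hp
  have hp0 : (0 : ℝ) < p := by linarith
  have key : ∀ l ∈ T, |(μloc l : ℝ)| * ((p : ℝ) ^ (∑ ρ, l ρ)) ^ (-s)
      ≤ (if l = 0 then 1 else 0) + |(μloc l : ℝ)| * (p : ℝ) ^ (-(2 * s)) := by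
    intro l _
    split_ifs with h
    · subst h
      simp only [h0, Pi.zero_apply, Finset.sum_const_zero, pow_zero, Real.one_rpow]
      have := Real.rpow_nonneg hp0.le (-(2 * s))
      simpa using this
    · rw [zero_add]
      by_cases hl : ∑ ρ, l ρ = 1
      · simp [h1 l hl]
      · have hl0 : ∑ ρ, l ρ ≠ 0 := fun h' =>
          h (funext fun i => Finset.sum_eq_zero_iff.1 h' i (Finset.mem_univ _))
        have h2 : (2 : ℝ) ≤ ((∑ ρ, l ρ : ℕ) : ℝ) := by
          exact_mod_cast (by omega : 2 ≤ ∑ ρ, l ρ)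
        refine mul_le_mul_of_nonneg_left ?_ (abs_nonneg _)
        rw [← Real.rpow_natCast, ← Real.rpow_mul hp0.le]
        exact Real.rpow_le_rpow_of_exponent_le hp' (by nlinarith)
  refine (Finset.sum_le_sum key).trans ?_
  rw [Finset.sum_add_distrib, ← Finset.sum_mul]
  gcongr
  rw [Finset.sum_ite_eq']
  split_ifs <;> norm_num

/-- The Dirichlet series `Σ |μ(d)| Π(d)^{-s}` has bounded partial sums for `s > 1/2`. -/
theorem exists_sum_abs_muGlob_mul_rpow_le {S : Type*} [Fintype S] [DecidableEq S]
    {μloc : (S → ℕ) → ℤ} (h0 : μloc 0 = 1)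
    (h1 : ∀ l : S → ℕ, ∑ ρ, l ρ = 1 → μloc l = 0)
    (h3 : ∀ l : S → ℕ, (∃ ρ, 3 ≤ l ρ) → μloc l = 0) {s : ℝ} (hs : 1 / 2 < s) :
    ∃ M : ℝ, 0 < M ∧ ∀ F : Finset (S → ℕ), (∀ d ∈ F, ∀ ρ, 0 < d ρ) →
      ∑ d ∈ F, |(muGlob μloc d : ℝ)| * ((∏ ρ, d ρ : ℕ) : ℝ) ^ (-s) ≤ M := by
  classical
  set T : Finset (S → ℕ) := Finset.Iic fun _ => 2 with hT
  set B : ℝ := ∑ l ∈ T, |(μloc l : ℝ)| with hB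
  have hB0 : 0 ≤ B := Finset.sum_nonneg fun _ _ => abs_nonneg _
  have hsum : Summable fun n : ℕ => (n : ℝ) ^ (-(2 * s)) :=
    Real.summable_nat_rpow.2 (by linarith)
  refine ⟨Real.exp (B * ∑' n : ℕ, (n : ℝ) ^ (-(2 * s))), Real.exp_pos _, fun F hF => ?_⟩
  set P : Finset ℕ := F.biUnion fun d => Finset.univ.biUnion fun ρ => (d ρ).primeFactors with hPdef
  have hP : ∀ p ∈ P, p.Prime := by
    intro p hp
    simp only [hPdef, Finset.mem_biUnion] at hp
    obtain ⟨d, -, ρ, -, h⟩ := hp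
    exact Nat.prime_of_mem_primeFactors h
  have hPd : ∀ d ∈ F, ∀ ρ, (d ρ).primeFactors ⊆ P := fun d hd ρ p hp =>
    Finset.mem_biUnion.2 ⟨d, hd, Finset.mem_biUnion.2 ⟨ρ, Finset.mem_univ _, hp⟩⟩
  let g : ℕ → (S → ℕ) → ℝ := fun p l => |(μloc l : ℝ)| * ((p : ℝ) ^ (∑ ρ, l ρ)) ^ (-s)
  have hg0 : ∀ p l, 0 ≤ g p l := fun p l =>
    mul_nonneg (abs_nonneg _) (Real.rpow_nonneg (by positivity) _)
  let v : (S → ℕ) → P → S → ℕ := fun d p ρ => (d ρ).factorization p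
  have hterm : ∀ d ∈ F, |(muGlob μloc d : ℝ)| * ((∏ ρ, d ρ : ℕ) : ℝ) ^ (-s)
      = ∏ p : P, g p (v d p) := by
    intro d hd
    rw [muGlob_eq_prod h0 hP (hPd d hd), prod_eq_prod_pow_sum_factorization (hF d hd) (hPd d hd)]
    push_cast
    rw [Finset.abs_prod, ← Real.finsetProd_rpow _ _ fun p _ => by positivity,
      ← Finset.prod_mul_distrib]
    exact (Finset.prod_coe_sort P fun p => g p fun ρ => (d ρ).factorization p).symm
  have hinj : Set.InjOn v F := by
    intro d hd e he hde
    ext ρ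
    refine Nat.eq_of_factorization_eq (hF d hd ρ).ne' (hF e he ρ).ne' fun p => ?_
    by_cases hp : p ∈ P
    · exact congrFun (congrFun hde ⟨p, hp⟩) ρ
    · rw [Finsupp.notMem_support_iff.1 fun h => hp (hPd d hd ρ h),
        Finsupp.notMem_support_iff.1 fun h => hp (hPd e he ρ h)]
  calc ∑ d ∈ F, |(muGlob μloc d : ℝ)| * ((∏ ρ, d ρ : ℕ) : ℝ) ^ (-s)
      = ∑ d ∈ F, ∏ p : P, g p (v d p) := Finset.sum_congr rfl hterm
    _ = ∑ φ ∈ F.image v, ∏ p : P, g p (φ p) :=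
        (Finset.sum_image (f := fun φ : P → S → ℕ => ∏ p : P, g p (φ p)) hinj).symm
    _ ≤ ∑ φ ∈ Fintype.piFinset fun _ : P => T, ∏ p : P, g p (φ p) := by
        rw [← Finset.sum_filter_ne_zero]
        refine Finset.sum_le_sum_of_subset_of_nonneg (fun φ hφ => ?_)
          fun φ _ _ => Finset.prod_nonneg fun p _ => hg0 p _
        replace hφ := (Finset.mem_filter.1 hφ).2
        rw [Fintype.mem_piFinset]
        intro p
        rw [hT, Finset.mem_Iic]
        intro ρ
        by_contra hlt
        refine hφ (Finset.prod_eq_zero (Finset.mem_univ p) ?_)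
        simp [g, h3 (φ p) ⟨ρ, by simp at hlt; omega⟩]
    _ = ∏ p : P, ∑ l ∈ T, g p l :=
        (Finset.prod_univ_sum (fun _ : P => T) fun p l => g p l).symm
    _ = ∏ p ∈ P, ∑ l ∈ T, g p l := Finset.prod_coe_sort P fun p => ∑ l ∈ T, g p l
    _ ≤ ∏ p ∈ P, Real.exp (B * (p : ℝ) ^ (-(2 * s))) := by
        refine Finset.prod_le_prod (fun p _ => Finset.sum_nonneg fun l _ => hg0 p l) fun p hp => ?_
        refine (sum_abs_mul_rpow_le h0 h1 T (by linarith) (hP p hp).one_le).trans ?_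
        rw [add_comm]
        exact Real.add_one_le_exp _
    _ = Real.exp (B * ∑ p ∈ P, (p : ℝ) ^ (-(2 * s))) := by
        rw [← Real.exp_sum, Finset.mul_sum]
    _ ≤ Real.exp (B * ∑' n : ℕ, (n : ℝ) ^ (-(2 * s))) := by
        gcongr
        exact hsum.sum_le_tsum _ fun n _ => Real.rpow_nonneg (by positivity) _

/-- For every `ε ∈ (0, 1/2)` there is a constant `C > 0` with
`Σ_{Π(d) ≥ Y} |μ(d)|/Π(d) ≤ C · Y^{-(1/2 - ε)}` for all `Y > 1`, the sum being over
positive tuples `d` with `Π(d) ≥ Y`. -/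
theorem stmt14 (S : Type*) [Fintype S] [DecidableEq S] [Nonempty S]
    (m : ℕ) (Λ : Fin m → S → ℕ)
    (hsum : ∀ i, 2 ≤ ∑ ρ, Λ i ρ) (hle : ∀ i ρ, Λ i ρ ≤ 2)
    (μloc : (S → ℕ) → ℤ)
    (hμ : ∀ τ : S → ℕ,
      (if ∀ i, ∃ ρ, τ ρ < Λ i ρ then (1 : ℤ) else 0) = ∑ l ∈ Finset.Iic τ, μloc l) :
    ∀ ε : ℝ, 0 < ε → ε < 1 / 2 → ∃ C : ℝ, 0 < C ∧ ∀ Y : ℝ, 1 < Y →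
      (∑' d : {d : S → ℕ // (∀ ρ, 0 < d ρ) ∧ Y ≤ ((∏ ρ, d ρ : ℕ) : ℝ)},
          (|muGlob μloc d.1| : ℝ) / ((∏ ρ, d.1 ρ : ℕ) : ℝ))
        ≤ C * Y ^ (-((1 : ℝ) / 2 - ε)) := by
  intro ε hε hε2
  set f : (S → ℕ) → ℤ := fun τ => if ∀ i, ∃ ρ, τ ρ < Λ i ρ then (1 : ℤ) else 0 with hfdef
  have hf1 : ∀ τ : S → ℕ, ∑ ρ, τ ρ ≤ 1 → f τ = 1 := by
    intro τ hτ
    refine if_pos fun i => ?_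
    by_contra! h
    have := Finset.sum_le_sum fun ρ (_ : ρ ∈ Finset.univ) => h ρ
    have := hsum i
    omega
  have hf3 : ∀ (ρ : S) (τ : S → ℕ), 3 ≤ τ ρ → f (Function.update τ ρ (τ ρ - 1)) = f τ := by
    intro ρ τ hτ
    have : ∀ i σ, Function.update τ ρ (τ ρ - 1) σ < Λ i σ ↔ τ σ < Λ i σ := by
      intro i σ
      by_cases h : σ = ρ
      · subst h
        have := hle i σ
        simp only [Function.update_self]
        omega
      · simp [h]
    simp only [hfdef, this]
  obtain ⟨h0, h1⟩ := coeff_zero_and_coeff_eq_zero_of_sum_eq_one (f := f) hμ hf1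
  have h3 : ∀ l : S → ℕ, (∃ ρ, 3 ≤ l ρ) → μloc l = 0 := fun l ⟨ρ, hl⟩ =>
    coeff_eq_zero_of_three_le (f := f) hμ ρ (hf3 ρ) l hl
  obtain ⟨M, hM, hbound⟩ := exists_sum_abs_muGlob_mul_rpow_le h0 h1 h3
    (s := 1 / 2 + ε) (by linarith)
  refine ⟨M, hM, fun Y hY => ?_⟩
  have hY0 : 0 < Y := by linarith
  have hYpow : 0 ≤ Y ^ (-((1 : ℝ) / 2 - ε)) := Real.rpow_nonneg hY0.le _
  refine Real.tsum_le_of_sum_le (fun d => by positivity) fun F => ?_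
  have hrankin : ∀ d ∈ F, (|muGlob μloc d.1| : ℝ) / ((∏ ρ, d.1 ρ : ℕ) : ℝ)
      ≤ |(muGlob μloc d.1 : ℝ)| * ((∏ ρ, d.1 ρ : ℕ) : ℝ) ^ (-(1 / 2 + ε))
        * Y ^ (-((1 : ℝ) / 2 - ε)) := by
    rintro ⟨d, hd, hdY⟩ -
    have hN : (0 : ℝ) < ((∏ ρ, d ρ : ℕ) : ℝ) := hY0.trans_le hdY
    rw [div_eq_mul_inv, mul_assoc]
    refine mul_le_mul_of_nonneg_left ?_ (abs_nonneg _)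
    calc (((∏ ρ, d ρ : ℕ) : ℝ))⁻¹
        = ((∏ ρ, d ρ : ℕ) : ℝ) ^ (-(1 / 2 + ε))
          * ((∏ ρ, d ρ : ℕ) : ℝ) ^ (-((1 : ℝ) / 2 - ε)) := by
          rw [← Real.rpow_add hN, ← Real.rpow_neg_one]
          congr 1
          ring
      _ ≤ _ := mul_le_mul_of_nonneg_left
          (Real.rpow_le_rpow_of_nonpos hY0 hdY (by linarith)) (Real.rpow_nonneg hN.le _)
  refine (Finset.sum_le_sum hrankin).trans ?_
  rw [← Finset.sum_mul]
  refine mul_le_mul_of_nonneg_right ?_ hYpow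
  have := hbound (F.map (Function.Embedding.subtype _)) (by
    intro d hd
    obtain ⟨e, -, rfl⟩ := Finset.mem_map.1 hd
    exact e.2.1)
  rwa [Finset.sum_map] at this
end
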